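/- The relaxed dual bound fails to be a worst-case bound: Let H be a real Hilbert space and φ : ℝ → H a Borel-measurable map satisfying ⟪φ(x), φ(y)⟫ = exp(−(x − y)²/4) for all x, y ∈ ℝ, and let ε = √(2 − 2/e). Then there exists a probability measure P' on ℝ (namely P' = (1/2)δ_0 + (1/2)δ_2) with ‖∫ φ dP' − φ(0)‖ ≤ ε such that ∫ max(|ξ| − 1, 0) dP'(ξ) = 1/2, which strictly exceeds the value 0 of the relaxed problem that enforces the majorization constraint only at the empirical sample ξ = 0. Hence relaxing the semi-infinite constraint of the kernel-DRO dual to hold only at the empirical samples does not upper-bound the worst-case risk over the norm-ball ambiguity set. -/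

import Mathlib

open MeasureTheory
open scoped RealInnerProductSpace

/-- The uniform probability measure on the two points `0` and `2`. -/
noncomputable def twoPointMeasure : Measure ℝ :=
  (2⁻¹ : ENNReal) • Measure.dirac 0 + (2⁻¹ : ENNReal) • Measure.dirac 2

instance : IsProbabilityMeasure twoPointMeasure :=
  ⟨by simp [twoPointMeasure, ENNReal.inv_two_add_inv_two]⟩

lemma integral_twoPointMeasure {E : Type*} [NormedAddCommGroup E] [NormedSpace ℝ E]
    [CompleteSpace E] (f : ℝ → E) :
    ∫ x, f x ∂twoPointMeasure = (2⁻¹ : ℝ) • f 0 + (2⁻¹ : ℝ) • f 2 := by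
  have hint (a : ℝ) : Integrable f ((2⁻¹ : ENNReal) • Measure.dirac a) :=
    (integrable_dirac (by simp)).smul_measure (by simp)
  rw [twoPointMeasure, integral_add_measure (hint 0) (hint 2)]
  simp [integral_smul_measure]

lemma norm_sq_sub_of_gaussian_kernel {H : Type*} [NormedAddCommGroup H] [InnerProductSpace ℝ H]
    {φ : ℝ → H} (hk : ∀ x y : ℝ, ⟪φ x, φ y⟫ = Real.exp (-(x - y) ^ 2 / 4)) (x y : ℝ) :
    ‖φ x - φ y‖ ^ 2 = 2 - 2 * Real.exp (-(x - y) ^ 2 / 4) := by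
  rw [norm_sub_sq_real, ← real_inner_self_eq_norm_sq, ← real_inner_self_eq_norm_sq, hk, hk, hk]
  simp only [sub_self, ne_eq, OfNat.ofNat_ne_zero, not_false_eq_true, zero_pow, neg_zero,
    zero_div, Real.exp_zero]
  ring

/-- The relaxed dual bound fails to be a worst-case bound: there is a
probability measure `P'` in the norm-ball ambiguity set of radius
`ε = √(2 − 2/e)` around `φ(0)` whose risk is `1/2`, strictly exceeding the
value `0` of the relaxed problem. -/
theorem relaxed_dual_not_worst_case_bound
    {H : Type*} [NormedAddCommGroup H] [InnerProductSpace ℝ H]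
    [MeasurableSpace H] [BorelSpace H]
    (φ : ℝ → H) (hφ : Measurable φ)
    (hk : ∀ x y : ℝ, ⟪φ x, φ y⟫ = Real.exp (-(x - y) ^ 2 / 4)) :
    ∃ P' : Measure ℝ, IsProbabilityMeasure P' ∧
      ‖(∫ ξ, φ ξ ∂P') - φ 0‖ ≤ Real.sqrt (2 - 2 / Real.exp 1) ∧
      (∫ ξ, max (|ξ| - 1) 0 ∂P') = 1 / 2 ∧ (0 : ℝ) < 1 / 2 := by
  refine ⟨twoPointMeasure, inferInstance, Real.le_sqrt_of_sq_le ?_, ?_, by norm_num⟩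
  · by_cases hH : CompleteSpace H
    · have hsub : (2⁻¹ : ℝ) • φ 0 + (2⁻¹ : ℝ) • φ 2 - φ 0 = (2⁻¹ : ℝ) • (φ 2 - φ 0) := by module
      have hdist : ‖φ 2 - φ 0‖ ^ 2 = 2 - 2 / Real.exp 1 := by
        rw [norm_sq_sub_of_gaussian_kernel hk, div_eq_mul_inv 2 (Real.exp 1), ← Real.exp_neg]
        norm_num
      rw [integral_twoPointMeasure, hsub, norm_smul, mul_pow, ← hdist]
      norm_num
      nlinarith [sq_nonneg ‖φ 2 - φ 0‖]
    · have hnorm : ‖φ 0‖ ^ 2 = 1 := by rw [← real_inner_self_eq_norm_sq, hk]; simp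
      have hexp : 2 / Real.exp 1 ≤ 1 := by
        rw [div_le_one (Real.exp_pos 1)]
        linarith [Real.add_one_le_exp 1]
      simp only [integral, hH, dite_false, zero_sub, norm_neg, hnorm]
      linarith
  · rw [integral_twoPointMeasure]
    norm_num
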